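/- Let a < b be real numbers, let α ∈ (0,1), let K ≥ 2 be an integer, and let x : [a,b] → ℝ be twice continuously differentiable. For t ∈ (a,b], define the truncation error E(t) = ₐᶜDₜᵅ x(t) − [ A(α,K)(t−a)^(−α) x(t) + B(α,K)(t−a)^(1−α) x′(t) − Σ_{p=2}^{K} C(α,p)(t−a)^(1−p−α) V_p(t) − x(a)(t−a)^(−α)/Γ(1−α) ]. Then for every t ∈ (a,b], |E(t)| ≤ max_{τ∈[a,t]} |x″(τ)| · exp((1−α)² + 1−α) / (Γ(2−α)(1−α) K^(1−α)) · (t−a)^(2−α). -/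

import Mathlib

/-- The coefficient of `u ^ n` in the binomial series of `(1 - u) ^ (-β)`. -/
noncomputable def negBinomialCoeff (β : ℝ) (n : ℕ) : ℝ :=
  ∏ j ∈ Finset.range n, (β + j) / (j + 1)

@[simp]
lemma negBinomialCoeff_zero (β : ℝ) : negBinomialCoeff β 0 = 1 := by
  simp [negBinomialCoeff]

lemma negBinomialCoeff_succ (β : ℝ) (n : ℕ) :
    negBinomialCoeff β (n + 1) = negBinomialCoeff β n * ((β + n) / (n + 1)) :=
  Finset.prod_range_succ _ _

lemma succ_mul_negBinomialCoeff_succ (β : ℝ) (n : ℕ) :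
    ((n : ℝ) + 1) * negBinomialCoeff β (n + 1) = β * negBinomialCoeff (β + 1) n := by
  induction n with
  | zero => simp [negBinomialCoeff]
  | succ n ih =>
    rw [negBinomialCoeff_succ β (n + 1), negBinomialCoeff_succ (β + 1) n, ← mul_assoc β, ← ih]
    push_cast
    field_simp
    ring

lemma sum_negBinomialCoeff (β : ℝ) (n : ℕ) :
    ∑ p ∈ Finset.range (n + 1), negBinomialCoeff β p = negBinomialCoeff (β + 1) n := by
  induction n with
  | zero => simp
  | succ n ih =>
    have h := succ_mul_negBinomialCoeff_succ β n
    rw [Finset.sum_range_succ, ih, negBinomialCoeff_succ (β + 1) n]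
    field_simp
    linear_combination h

lemma Gamma_nat_add_eq_negBinomialCoeff {β : ℝ} (hβ : ∀ n : ℕ, β ≠ -n) (n : ℕ) :
    Real.Gamma (n + β) = negBinomialCoeff β n * (Real.Gamma β * n.factorial) := by
  induction n with
  | zero => simp
  | succ n ih =>
    have h : (n : ℝ) + β ≠ 0 := fun h => hβ n (by linarith)
    rw [negBinomialCoeff_succ, Nat.factorial_succ,
      show ((n + 1 : ℕ) : ℝ) + β = (n + β) + 1 by push_cast; ring, Real.Gamma_add_one h, ih]
    push_cast
    field_simp
    ring

lemma negBinomialCoeff_le_rpow {α : ℝ} (hα : α ∈ Set.Icc (0 : ℝ) 1) (n : ℕ) :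
    negBinomialCoeff α n ≤ ((n : ℝ) + 1) ^ (-(1 - α)) := by
  induction n with
  | zero => simp
  | succ n ih =>
    have hn : (0 : ℝ) < n + 1 := by positivity
    have hb : (1 + 1 / ((n : ℝ) + 1)) ^ (1 - α) ≤ 1 + (1 - α) * (1 / ((n : ℝ) + 1)) :=
      rpow_one_add_le_one_add_mul_self (by have : 0 < 1 / ((n : ℝ) + 1) := by positivity
                                           linarith)
        (by linarith [hα.2]) (by linarith [hα.1])
    have hy : (0 : ℝ) < 1 + 1 / ((n : ℝ) + 1) := by positivity
    have hstep : (α + n) / (n + 1) ≤ (1 + 1 / ((n : ℝ) + 1)) ^ (-(1 - α)) := by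
      rw [Real.rpow_neg hy.le, ← one_div, le_div_iff₀ (by positivity)]
      have h0 : 0 ≤ (α + n) / ((n : ℝ) + 1) :=
        div_nonneg (add_nonneg hα.1 (Nat.cast_nonneg n)) hn.le
      have h1 : (α + n) / ((n : ℝ) + 1) = 1 - (1 - α) * (1 / ((n : ℝ) + 1)) := by
        field_simp
        ring
      calc _ ≤ (α + n) / ((n : ℝ) + 1) * (1 + (1 - α) * (1 / ((n : ℝ) + 1))) := by gcongr
        _ ≤ 1 := by
          rw [h1]
          nlinarith [sq_nonneg ((1 - α) * (1 / ((n : ℝ) + 1)))]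
    have he : ((n + 1 : ℕ) : ℝ) + 1 = (n + 1) * (1 + 1 / ((n : ℝ) + 1)) := by
      push_cast
      field_simp
    rw [negBinomialCoeff_succ, he, Real.mul_rpow hn.le hy.le]
    exact mul_le_mul ih hstep (div_nonneg (add_nonneg hα.1 (Nat.cast_nonneg n)) hn.le)
      (by positivity)

/-- The remainder of the binomial series of `(1 - u) ^ (-β)` after the first `n` terms. -/
noncomputable def negBinomialRemainder (β : ℝ) (n : ℕ) (u : ℝ) : ℝ :=
  (1 - u) ^ (-β) - ∑ p ∈ Finset.range n, negBinomialCoeff β p * u ^ p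

lemma hasDerivAt_negBinomialRemainder (β : ℝ) (n : ℕ) {u : ℝ} (hu : u < 1) :
    HasDerivAt (negBinomialRemainder β (n + 1)) (β * negBinomialRemainder (β + 1) n u) u := by
  have h1 : HasDerivAt (fun v : ℝ => (1 - v) ^ (-β)) (-1 * -β * (1 - u) ^ (-β - 1)) u :=
    ((hasDerivAt_id u).const_sub 1).rpow_const (Or.inl (by simp only [id]; linarith))
  have h2 : HasDerivAt (fun v : ℝ => ∑ p ∈ Finset.range (n + 1), negBinomialCoeff β p * v ^ p)
      (∑ p ∈ Finset.range (n + 1), negBinomialCoeff β p * (p * u ^ (p - 1))) u :=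
    HasDerivAt.fun_sum fun p _ => (hasDerivAt_pow p u).const_mul _
  refine (h1.sub h2).congr_deriv ?_
  rw [Finset.sum_range_succ', negBinomialRemainder, mul_sub, Finset.mul_sum,
    show -(β + 1) = -β - 1 by ring]
  congr 1
  · ring
  · simp only [Nat.cast_zero, zero_mul, mul_zero, add_zero, Nat.add_sub_cancel]
    refine Finset.sum_congr rfl fun p _ => ?_
    rw [← mul_assoc β, ← succ_mul_negBinomialCoeff_succ]
    push_cast
    ring

lemma negBinomialRemainder_succ_zero (β : ℝ) (n : ℕ) : negBinomialRemainder β (n + 1) 0 = 0 := by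
  simp [negBinomialRemainder, Finset.sum_range_succ']

lemma negBinomialRemainder_nonneg {β : ℝ} (hβ : 0 ≤ β) (n : ℕ) {u : ℝ}
    (hu : u ∈ Set.Ico (0 : ℝ) 1) : 0 ≤ negBinomialRemainder β n u := by
  induction n generalizing β u with
  | zero => simpa [negBinomialRemainder] using Real.rpow_nonneg (by linarith [hu.2]) _
  | succ n ih =>
    have hmono : MonotoneOn (negBinomialRemainder β (n + 1)) (Set.Ico 0 1) := by
      refine monotoneOn_of_hasDerivWithinAt_nonneg (convex_Ico 0 1)
        (fun v hv => (hasDerivAt_negBinomialRemainder β n hv.2).continuousAt.continuousWithinAt)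
        (fun v hv => (hasDerivAt_negBinomialRemainder β n
          (interior_subset hv).2).hasDerivWithinAt) fun v hv => ?_
      exact mul_nonneg hβ (ih (by linarith) (interior_subset hv))
    rw [← negBinomialRemainder_succ_zero β n]
    exact hmono ⟨le_rfl, one_pos⟩ hu hu.1

lemma abs_negBinomialRemainder_le {α : ℝ} (hα : α ∈ Set.Ioo (0 : ℝ) 1) (n : ℕ) {u : ℝ}
    (hu : u ∈ Set.Icc (0 : ℝ) 1) :
    |negBinomialRemainder (α - 1) (n + 1) u| ≤ negBinomialCoeff α n := by
  have hanti : AntitoneOn (negBinomialRemainder (α - 1) (n + 1)) (Set.Icc 0 1) := by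
    refine antitoneOn_of_hasDerivWithinAt_nonpos (convex_Icc 0 1) ?_
      (fun v hv => (hasDerivAt_negBinomialRemainder (α - 1) n
        (interior_Icc.subset hv).2).hasDerivWithinAt) fun v hv => ?_
    · unfold negBinomialRemainder
      refine ContinuousOn.sub ?_ (by fun_prop)
      exact ContinuousOn.rpow_const (by fun_prop) fun v _ => Or.inr (by linarith [hα.2])
    · rw [sub_add_cancel]
      exact mul_nonpos_of_nonpos_of_nonneg (by linarith [hα.2])
        (negBinomialRemainder_nonneg hα.1.le n (Set.Ioo_subset_Ico_self (interior_Icc.subset hv)))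
  have h0 := hanti ⟨le_rfl, zero_le_one⟩ hu hu.1
  have h1 := hanti hu ⟨zero_le_one, le_rfl⟩ hu.2
  rw [negBinomialRemainder_succ_zero] at h0
  have hone : negBinomialRemainder (α - 1) (n + 1) 1 = -negBinomialCoeff α n := by
    have hs := sum_negBinomialCoeff (α - 1) n
    rw [sub_add_cancel] at hs
    simp [negBinomialRemainder, hs, Real.zero_rpow (show (1 : ℝ) - α ≠ 0 by linarith [hα.2])]
  rw [abs_of_nonpos h0]
  linarith

open intervalIntegral in
/-- Expansion of `∫ (t - τ) ^ (-α) * f' τ` by integrating by parts against the remainder of the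
binomial series. -/
lemma integral_rpow_mul_eq_integral_negBinomialRemainder_mul {a t α : ℝ} (hat : a < t)
    (hα : α ∈ Set.Ioo (0 : ℝ) 1) (n : ℕ) {g g' : ℝ → ℝ} (hg : ContinuousOn g (Set.Icc a t))
    (hg' : ContinuousOn g' (Set.Icc a t)) (hgg' : ∀ τ ∈ Set.Ioo a t, HasDerivAt g (g' τ) τ) :
    (1 - α) * ∫ τ in a..t, (t - τ) ^ (-α) * g τ =
      (∫ τ in a..t,
        (t - a) ^ (1 - α) * negBinomialRemainder (α - 1) (n + 1) ((τ - a) / (t - a)) * g' τ)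
      + (t - a) ^ (1 - α) * (∑ p ∈ Finset.range (n + 1), negBinomialCoeff (α - 1) p) * g t
      - (t - a) ^ (-α) * ∑ p ∈ Finset.range (n + 1), p * negBinomialCoeff (α - 1) p *
          ∫ τ in a..t, ((τ - a) / (t - a)) ^ (p - 1) * g τ := by
  have hh : 0 < t - a := sub_pos.2 hat
  have hI : Set.uIcc a t = Set.Icc a t := Set.uIcc_of_le hat.le
  set w : ℝ → ℝ := fun τ => (t - τ) ^ (1 - α) - (t - a) ^ (1 - α) *
    ∑ p ∈ Finset.range (n + 1), negBinomialCoeff (α - 1) p * ((τ - a) / (t - a)) ^ p with hw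
  set q : ℝ → ℝ := fun τ => (t - a) ^ (-α) * ∑ p ∈ Finset.range (n + 1),
    p * negBinomialCoeff (α - 1) p * ((τ - a) / (t - a)) ^ (p - 1) with hq
  have hpow : (t - a) ^ (1 - α) = (t - a) ^ (-α) * (t - a) := by
    rw [show 1 - α = -α + 1 by ring, Real.rpow_add_one hh.ne']
  have hwr : ∀ τ ∈ Set.Icc a t,
      (t - a) ^ (1 - α) * negBinomialRemainder (α - 1) (n + 1) ((τ - a) / (t - a)) = w τ := by
    intro τ hτ
    have h1 : 1 - (τ - a) / (t - a) = (t - τ) / (t - a) := by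
      field_simp
      ring
    rw [negBinomialRemainder, mul_sub, h1, neg_sub,
      Real.div_rpow (sub_nonneg.2 hτ.2) hh.le, mul_div_cancel₀ _ (by positivity)]
  have hwc : ContinuousOn w (Set.uIcc a t) := by
    refine ContinuousOn.sub ?_ (by fun_prop)
    exact ContinuousOn.rpow_const (by fun_prop) fun v _ => Or.inr (by linarith [hα.2])
  have hwd : ∀ τ ∈ Set.Ioo (min a t) (max a t),
      HasDerivAt w (-(1 - α) * (t - τ) ^ (-α) - q τ) τ := by
    intro τ hτ
    rw [min_eq_left hat.le, max_eq_right hat.le] at hτ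
    have h1 : HasDerivAt (fun v : ℝ => (t - v) ^ (1 - α))
        (-1 * (1 - α) * (t - τ) ^ (1 - α - 1)) τ :=
      ((hasDerivAt_id τ).const_sub t).rpow_const (Or.inl (by simp only [id]; linarith [hτ.2]))
    have h2 : HasDerivAt (fun v : ℝ => (t - a) ^ (1 - α) *
        ∑ p ∈ Finset.range (n + 1), negBinomialCoeff (α - 1) p * ((v - a) / (t - a)) ^ p)
        ((t - a) ^ (1 - α) * ∑ p ∈ Finset.range (n + 1), negBinomialCoeff (α - 1) p *
          (p * ((τ - a) / (t - a)) ^ (p - 1) * (1 / (t - a)))) τ :=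
      (HasDerivAt.fun_sum fun p _ =>
        ((((hasDerivAt_id τ).sub_const a).div_const (t - a)).fun_pow p).const_mul _).const_mul _
    refine (h1.sub h2).congr_deriv ?_
    rw [show 1 - α - 1 = -α by ring, hpow]
    simp only [hq, mul_assoc, Finset.mul_sum]
    congr 1
    · ring
    · refine Finset.sum_congr rfl fun p _ => ?_
      field_simp
  have hkint : IntervalIntegrable (fun τ : ℝ => (t - τ) ^ (-α)) MeasureTheory.volume a t := by
    have h := (intervalIntegrable_rpow' (a := t - a) (b := 0) (r := -α)
      (by linarith [hα.2])).comp_sub_left t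
    simpa using h
  have hqc : Continuous q := by
    simp only [hq]
    fun_prop
  have hw'int : IntervalIntegrable (fun τ => -(1 - α) * (t - τ) ^ (-α) - q τ)
      MeasureTheory.volume a t :=
    (hkint.const_mul _).sub (hqc.intervalIntegrable _ _)
  rw [← hI] at hg hg'
  have hparts := integral_mul_deriv_eq_deriv_mul_of_hasDerivAt hwc hg hwd
    (fun τ hτ => hgg' τ (by rwa [min_eq_left hat.le, max_eq_right hat.le] at hτ)) hw'int
    hg'.intervalIntegrable
  have hwa : w a = 0 := by simp [hw, Finset.sum_range_succ']
  have hwt : w t = -((t - a) ^ (1 - α) *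
      ∑ p ∈ Finset.range (n + 1), negBinomialCoeff (α - 1) p) := by
    simp [hw, div_self hh.ne', Real.zero_rpow (show (1 : ℝ) - α ≠ 0 by linarith [hα.2])]
  have hsplit : ∫ τ in a..t, (-(1 - α) * (t - τ) ^ (-α) - q τ) * g τ =
      -(1 - α) * (∫ τ in a..t, (t - τ) ^ (-α) * g τ) - ∫ τ in a..t, q τ * g τ := by
    have hqg : IntervalIntegrable (fun τ => q τ * g τ) MeasureTheory.volume a t :=
      (hqc.continuousOn.mul hg).intervalIntegrable
    rw [← integral_const_mul, ← integral_sub ((hkint.mul_continuousOn hg).const_mul _) hqg]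
    refine integral_congr fun τ _ => ?_
    ring
  have hqint : ∫ τ in a..t, q τ * g τ =
      (t - a) ^ (-α) * ∑ p ∈ Finset.range (n + 1), p * negBinomialCoeff (α - 1) p *
          ∫ τ in a..t, ((τ - a) / (t - a)) ^ (p - 1) * g τ := by
    simp_rw [← integral_const_mul]
    rw [← integral_finsetSum, ← integral_const_mul]
    · refine integral_congr fun τ _ => ?_
      simp only [hq, mul_assoc, Finset.sum_mul]
    · intro p _
      exact (ContinuousOn.const_mul (ContinuousOn.mul (by fun_prop) hg) _).intervalIntegrable
  have hW : (∫ τ in a..t,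
      (t - a) ^ (1 - α) * negBinomialRemainder (α - 1) (n + 1) ((τ - a) / (t - a)) * g' τ) =
      ∫ τ in a..t, w τ * g' τ :=
    integral_congr fun τ hτ => by simp only [hwr τ (hI ▸ hτ)]
  rw [hW, hparts, hsplit, hqint, hwa, hwt]
  ring

open intervalIntegral in
lemma integral_div_pow_succ_mul_deriv {a t : ℝ} (hat : a < t) (k : ℕ) {f f' : ℝ → ℝ}
    (hf : ContinuousOn f (Set.Icc a t)) (hf' : ContinuousOn f' (Set.Icc a t))
    (hff' : ∀ τ ∈ Set.Ioo a t, HasDerivAt f (f' τ) τ) :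
    ∫ τ in a..t, ((τ - a) / (t - a)) ^ (k + 1) * f' τ =
      f t - (k + 1) / (t - a) * ∫ τ in a..t, ((τ - a) / (t - a)) ^ k * f τ := by
  have hh : t - a ≠ 0 := (sub_pos.2 hat).ne'
  rw [← Set.uIcc_of_le hat.le] at hf hf'
  have hd : ∀ τ : ℝ, HasDerivAt (fun v : ℝ => ((v - a) / (t - a)) ^ (k + 1))
      ((k + 1 : ℕ) * ((τ - a) / (t - a)) ^ k * (1 / (t - a))) τ := fun τ =>
    (((hasDerivAt_id τ).sub_const a).div_const (t - a)).fun_pow (k + 1)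
  rw [integral_mul_deriv_eq_deriv_mul_of_hasDerivAt (by fun_prop) hf (fun τ _ => hd τ)
    (fun τ hτ => hff' τ (by rwa [min_eq_left hat.le, max_eq_right hat.le] at hτ))
    (Continuous.intervalIntegrable (by fun_prop) _ _) hf'.intervalIntegrable,
    ← integral_const_mul, div_self hh]
  simp only [one_pow, one_mul, sub_self, zero_div, ne_eq, Nat.add_eq_zero_iff, one_ne_zero,
    and_false, not_false_eq_true, zero_pow, zero_mul, sub_zero]
  congr 1
  refine integral_congr fun τ _ => ?_
  push_cast
  ring

open intervalIntegral in
/-- The truncation error of the Caputo derivative as an integral of the second derivative against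
the remainder of the binomial series. -/
lemma caputo_approximation_error_eq {a t α : ℝ} (hat : a < t) (hα : α ∈ Set.Ioo (0 : ℝ) 1)
    {K : ℕ} (hK : 1 ≤ K) {f f' f'' : ℝ → ℝ} (hf : ContinuousOn f (Set.Icc a t))
    (hf' : ContinuousOn f' (Set.Icc a t)) (hf'' : ContinuousOn f'' (Set.Icc a t))
    (hff' : ∀ τ ∈ Set.Ioo a t, HasDerivAt f (f' τ) τ)
    (hff'' : ∀ τ ∈ Set.Ioo a t, HasDerivAt f' (f'' τ) τ) :
    (1 / Real.Gamma (1 - α)) * (∫ τ in a..t, (t - τ) ^ (-α) * f' τ)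
        - (((1 / Real.Gamma (1 - α)) *
              (1 + ∑ p ∈ Finset.Icc 2 K,
                Real.Gamma ((p : ℝ) - 1 + α) / (Real.Gamma α * ((p - 1).factorial : ℝ))))
                * (t - a) ^ (-α) * f t
          + ((1 / Real.Gamma (2 - α)) *
              (1 + ∑ p ∈ Finset.Icc 1 K,
                Real.Gamma ((p : ℝ) - 1 + α) / (Real.Gamma (α - 1) * (p.factorial : ℝ))))
                * (t - a) ^ (1 - α) * f' t
          - ∑ p ∈ Finset.Icc 2 K,
              (Real.Gamma ((p : ℝ) - 1 + α) /
                  (Real.Gamma (2 - α) * Real.Gamma (α - 1) * ((p - 1).factorial : ℝ)))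
                * (t - a) ^ (1 - (p : ℝ) - α)
                * ((1 - (p : ℝ)) * ∫ τ in a..t, (τ - a) ^ ((p : ℝ) - 2) * f τ)
          - f a * (t - a) ^ (-α) / Real.Gamma (1 - α)) =
      (1 / Real.Gamma (2 - α)) * ∫ τ in a..t,
        (t - a) ^ (1 - α) * negBinomialRemainder (α - 1) (K + 1) ((τ - a) / (t - a)) * f'' τ := by
  obtain ⟨hα0, hα1⟩ := hα
  have hh : 0 < t - a := sub_pos.2 hat
  have hβ : ∀ n : ℕ, α - 1 ≠ -n := by
    rintro (_ | n) h
    · simp only [Nat.cast_zero] at h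
      linarith
    · push_cast at h
      linarith [Nat.cast_nonneg (α := ℝ) n]
  have hG1 : Real.Gamma (α - 1) ≠ 0 := Real.Gamma_ne_zero hβ
  have hG : Real.Gamma (1 - α) ≠ 0 := (Real.Gamma_pos_of_pos (by linarith)).ne'
  have hα1' : α - 1 ≠ 0 := by linarith
  have hα1'' : 1 - α ≠ 0 := by linarith
  have hGα : Real.Gamma α = (α - 1) * Real.Gamma (α - 1) := by
    rw [← Real.Gamma_add_one hα1', sub_add_cancel]
  have hG2 : Real.Gamma (2 - α) = (1 - α) * Real.Gamma (1 - α) := by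
    rw [← Real.Gamma_add_one hα1'']
    ring_nf
  have hGp : ∀ p : ℕ, Real.Gamma ((p : ℝ) - 1 + α) =
      negBinomialCoeff (α - 1) p * (Real.Gamma (α - 1) * p.factorial) := fun p => by
    rw [← Gamma_nat_add_eq_negBinomialCoeff hβ]
    ring_nf
  have hpow : (t - a) ^ (1 - α) = (t - a) ^ (-α) * (t - a) := by
    rw [show 1 - α = -α + 1 by ring, Real.rpow_add_one hh.ne']
  have hA : ∑ p ∈ Finset.Icc 2 K,
      Real.Gamma ((p : ℝ) - 1 + α) / (Real.Gamma α * ((p - 1).factorial : ℝ)) =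
      (∑ p ∈ Finset.Icc 2 K, (p : ℝ) * negBinomialCoeff (α - 1) p) / (α - 1) := by
    rw [Finset.sum_div]
    refine Finset.sum_congr rfl fun p hp => ?_
    obtain ⟨k, rfl⟩ := Nat.exists_eq_add_of_le' (Finset.mem_Icc.1 hp).1
    rw [hGp, hGα, show k + 2 - 1 = k + 1 by omega, Nat.factorial_succ (k + 1)]
    push_cast
    have : ((k + 1).factorial : ℝ) ≠ 0 := by positivity
    field_simp
    ring
  have hB : ∑ p ∈ Finset.Icc 1 K,
      Real.Gamma ((p : ℝ) - 1 + α) / (Real.Gamma (α - 1) * (p.factorial : ℝ)) =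
      ∑ p ∈ Finset.Icc 1 K, negBinomialCoeff (α - 1) p := by
    refine Finset.sum_congr rfl fun p _ => ?_
    have : (p.factorial : ℝ) ≠ 0 := by positivity
    rw [hGp]
    field_simp
  have hC : ∑ p ∈ Finset.Icc 2 K,
      (Real.Gamma ((p : ℝ) - 1 + α) /
          (Real.Gamma (2 - α) * Real.Gamma (α - 1) * ((p - 1).factorial : ℝ)))
        * (t - a) ^ (1 - (p : ℝ) - α)
        * ((1 - (p : ℝ)) * ∫ τ in a..t, (τ - a) ^ ((p : ℝ) - 2) * f τ) =
      (t - a) ^ (-α) / Real.Gamma (2 - α) * ∑ p ∈ Finset.Icc 2 K, p * negBinomialCoeff (α - 1) p *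
        ((∫ τ in a..t, ((τ - a) / (t - a)) ^ (p - 1) * f' τ) - f t) := by
    rw [Finset.mul_sum]
    refine Finset.sum_congr rfl fun p hp => ?_
    obtain ⟨k, rfl⟩ := Nat.exists_eq_add_of_le' (Finset.mem_Icc.1 hp).1
    have hint : ∫ τ in a..t, (τ - a) ^ (((k + 2 : ℕ) : ℝ) - 2) * f τ =
        (t - a) ^ k * ∫ τ in a..t, ((τ - a) / (t - a)) ^ k * f τ := by
      rw [← integral_const_mul]
      refine integral_congr fun τ _ => ?_
      rw [show (((k + 2 : ℕ) : ℝ) - 2) = k by push_cast; ring, Real.rpow_natCast, div_pow]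
      field_simp
    have hexp : (t - a) ^ (1 - ((k + 2 : ℕ) : ℝ) - α) = (t - a) ^ (-α) / (t - a) ^ (k + 1) := by
      rw [← Real.rpow_natCast (t - a) (k + 1), ← Real.rpow_sub hh]
      congr 1
      push_cast
      ring
    rw [hint, hexp, hGp, hG2, show k + 2 - 1 = k + 1 by omega, Nat.factorial_succ (k + 1),
      integral_div_pow_succ_mul_deriv hat k hf hf' hff']
    push_cast
    have : ((k + 1).factorial : ℝ) ≠ 0 := by positivity
    field_simp
    ring
  have hone : ∫ τ in a..t, ((τ - a) / (t - a)) ^ (1 - 1) * f' τ = f t - f a := by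
    simp only [Nat.sub_self, pow_zero, one_mul]
    refine integral_eq_sub_of_hasDerivAt_of_le hat.le hf hff' ?_
    rw [← Set.uIcc_of_le hat.le] at hf'
    exact hf'.intervalIntegrable
  have hsum1 : ∀ F : ℕ → ℝ, ∑ p ∈ Finset.range (K + 1), F p = F 0 + ∑ p ∈ Finset.Icc 1 K, F p := by
    intro F
    rw [Finset.range_eq_Ico, Finset.sum_eq_sum_Ico_succ_bot K.succ_pos]
    rfl
  have hsum2 : ∀ F : ℕ → ℝ, ∑ p ∈ Finset.Icc 1 K, F p = F 1 + ∑ p ∈ Finset.Icc 2 K, F p := by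
    intro F
    change ∑ p ∈ Finset.Ico 1 (K + 1), F p = _
    rw [Finset.sum_eq_sum_Ico_succ_bot (by omega)]
    rfl
  have hkey := integral_rpow_mul_eq_integral_negBinomialRemainder_mul hat ⟨hα0, hα1⟩ K
    hf' hf'' hff''
  set W := ∫ τ in a..t,
    (t - a) ^ (1 - α) * negBinomialRemainder (α - 1) (K + 1) ((τ - a) / (t - a)) * f'' τ
  clear_value W
  rw [hsum1, hsum1, hsum2 fun p => (p : ℝ) * _ * _, hone, hpow] at hkey
  have hc1 : negBinomialCoeff (α - 1) 1 = α - 1 := by simp [negBinomialCoeff]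
  simp only [Nat.cast_zero, zero_mul, zero_add, Nat.cast_one, one_mul, hc1,
    negBinomialCoeff_zero] at hkey
  rw [hA, hB, hC, hG2, hpow]
  simp only [mul_sub, Finset.sum_sub_distrib, ← Finset.sum_mul]
  rw [div_eq_mul_inv (∑ p ∈ Finset.Icc 2 K, (p : ℝ) * negBinomialCoeff (α - 1) p),
    show (α - 1)⁻¹ = -(1 - α)⁻¹ by rw [← inv_neg, neg_sub]]
  field_simp
  linear_combination hkey

/-- Error bound for the finite-sum approximation of the left Caputo fractional
derivative:
`|ₐᶜDₜᵅ x(t) − [A(α,K)(t−a)^(−α)x(t) + B(α,K)(t−a)^(1−α)x′(t)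
  − Σ_{p=2}^K C(α,p)(t−a)^(1−p−α)V_p(t) − x(a)(t−a)^(−α)/Γ(1−α)]|
  ≤ max_{τ∈[a,t]} |x″(τ)| · exp((1−α)²+1−α)/(Γ(2−α)(1−α)K^(1−α)) · (t−a)^(2−α)`. -/
theorem caputo_approximation_error_bound
    (a b α : ℝ) (hab : a < b) (hα : α ∈ Set.Ioo (0 : ℝ) 1)
    (K : ℕ) (hK : 2 ≤ K)
    (x : ℝ → ℝ) (hx : ContDiffOn ℝ 2 x (Set.Icc a b)) :
    ∀ t ∈ Set.Ioc a b,
      |(1 / Real.Gamma (1 - α)) *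
          (∫ τ in a..t, (t - τ) ^ (-α) * derivWithin x (Set.Icc a b) τ)
        - (((1 / Real.Gamma (1 - α)) *
              (1 + ∑ p ∈ Finset.Icc 2 K,
                Real.Gamma ((p : ℝ) - 1 + α) / (Real.Gamma α * ((p - 1).factorial : ℝ))))
                * (t - a) ^ (-α) * x t
          + ((1 / Real.Gamma (2 - α)) *
              (1 + ∑ p ∈ Finset.Icc 1 K,
                Real.Gamma ((p : ℝ) - 1 + α) / (Real.Gamma (α - 1) * (p.factorial : ℝ))))
                * (t - a) ^ (1 - α) * derivWithin x (Set.Icc a b) t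
          - ∑ p ∈ Finset.Icc 2 K,
              (Real.Gamma ((p : ℝ) - 1 + α) /
                  (Real.Gamma (2 - α) * Real.Gamma (α - 1) * ((p - 1).factorial : ℝ)))
                * (t - a) ^ (1 - (p : ℝ) - α)
                * ((1 - (p : ℝ)) * ∫ τ in a..t, (τ - a) ^ ((p : ℝ) - 2) * x τ)
          - x a * (t - a) ^ (-α) / Real.Gamma (1 - α))|
      ≤ sSup ((fun τ => |iteratedDerivWithin 2 x (Set.Icc a b) τ|) '' Set.Icc a t)
          * (Real.exp ((1 - α) ^ 2 + (1 - α)) /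
              (Real.Gamma (2 - α) * (1 - α) * (K : ℝ) ^ (1 - α)))
          * (t - a) ^ (2 - α) := by
  intro t ht
  have hat : a < t := ht.1
  have hh : 0 < t - a := sub_pos.2 hat
  have hsub : Set.Icc a t ⊆ Set.Icc a b := Set.Icc_subset_Icc_right ht.2
  have hud : UniqueDiffOn ℝ (Set.Icc a b) := uniqueDiffOn_Icc hab
  have hx' : ContDiffOn ℝ 1 (derivWithin x (Set.Icc a b)) (Set.Icc a b) :=
    hx.derivWithin hud (by norm_num)
  have hx'' : ContinuousOn (iteratedDerivWithin 2 x (Set.Icc a b)) (Set.Icc a b) :=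
    hx.continuousOn_iteratedDerivWithin (by norm_num) hud
  have hmem : ∀ τ ∈ Set.Ioo a t, Set.Icc a b ∈ nhds τ := fun τ hτ =>
    Icc_mem_nhds hτ.1 (hτ.2.trans_le ht.2)
  have hd : ∀ τ ∈ Set.Ioo a t, HasDerivAt x (derivWithin x (Set.Icc a b) τ) τ := fun τ hτ =>
    (hx.differentiableOn (by norm_num) τ
      (mem_of_mem_nhds (hmem τ hτ))).hasDerivWithinAt.hasDerivAt (hmem τ hτ)
  have hd' : ∀ τ ∈ Set.Ioo a t, HasDerivAt (derivWithin x (Set.Icc a b))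
      (iteratedDerivWithin 2 x (Set.Icc a b) τ) τ := fun τ hτ => by
    have h := (hx'.differentiableOn (by norm_num) τ
      (mem_of_mem_nhds (hmem τ hτ))).hasDerivWithinAt.hasDerivAt (hmem τ hτ)
    rwa [show (2 : ℕ) = 1 + 1 from rfl, iteratedDerivWithin_succ, iteratedDerivWithin_one]
  rw [caputo_approximation_error_eq hat hα (by omega) (hx.continuousOn.mono hsub)
    (hx'.continuousOn.mono hsub) (hx''.mono hsub) hd hd']
  set M := sSup ((fun τ => |iteratedDerivWithin 2 x (Set.Icc a b) τ|) '' Set.Icc a t) with hM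
  have hMle : ∀ τ ∈ Set.Icc a t, |iteratedDerivWithin 2 x (Set.Icc a b) τ| ≤ M := fun τ hτ =>
    le_csSup (isCompact_Icc.image_of_continuousOn (hx''.mono hsub).abs).bddAbove
      (Set.mem_image_of_mem _ hτ)
  have hM0 : 0 ≤ M := (abs_nonneg _).trans (hMle a ⟨le_rfl, hat.le⟩)
  have hK0 : (0 : ℝ) < K := by exact_mod_cast (by omega : 0 < K)
  have hα1 : 0 < 1 - α := sub_pos.2 hα.2
  have hG2 : 0 < Real.Gamma (2 - α) := Real.Gamma_pos_of_pos (by linarith)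
  have hcoeff : negBinomialCoeff α K ≤ 1 / (K : ℝ) ^ (1 - α) := by
    rw [one_div, ← Real.rpow_neg hK0.le]
    exact (negBinomialCoeff_le_rpow ⟨hα.1.le, hα.2.le⟩ K).trans
      (Real.rpow_le_rpow_of_nonpos hK0 (by linarith) (by linarith))
  have hint := intervalIntegral.norm_integral_le_of_norm_le_const (a := a) (b := t)
    (f := fun τ => (t - a) ^ (1 - α) *
      negBinomialRemainder (α - 1) (K + 1) ((τ - a) / (t - a)) *
        iteratedDerivWithin 2 x (Set.Icc a b) τ)
    (C := (t - a) ^ (1 - α) * (1 / (K : ℝ) ^ (1 - α)) * M) fun τ hτ => by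
      rw [Set.uIoc_of_le hat.le] at hτ
      rw [Real.norm_eq_abs, abs_mul, abs_mul, abs_of_pos (Real.rpow_pos_of_pos hh _)]
      have hu : (τ - a) / (t - a) ∈ Set.Icc (0 : ℝ) 1 :=
        ⟨div_nonneg (sub_pos.2 hτ.1).le hh.le, (div_le_one hh).2 (by linarith [hτ.2])⟩
      gcongr
      · exact (abs_negBinomialRemainder_le hα K hu).trans hcoeff
      · exact hMle τ (Set.Ioc_subset_Icc_self hτ)
  rw [Real.norm_eq_abs, abs_of_pos hh] at hint
  have hpow : (t - a) ^ (2 - α) = (t - a) ^ (1 - α) * (t - a) := by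
    rw [← Real.rpow_add_one hh.ne']
    ring_nf
  have hexp : 1 ≤ Real.exp ((1 - α) ^ 2 + (1 - α)) / (1 - α) := by
    rw [one_le_div hα1]
    have := Real.one_le_exp (show 0 ≤ (1 - α) ^ 2 + (1 - α) by positivity)
    linarith [hα.1]
  rw [abs_mul, abs_of_pos (one_div_pos.2 hG2), hpow]
  calc _ ≤ 1 / Real.Gamma (2 - α) *
        ((t - a) ^ (1 - α) * (1 / (K : ℝ) ^ (1 - α)) * M * (t - a)) := by gcongr
    _ ≤ 1 / Real.Gamma (2 - α) *
        ((t - a) ^ (1 - α) * (1 / (K : ℝ) ^ (1 - α)) * M * (t - a)) *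
          (Real.exp ((1 - α) ^ 2 + (1 - α)) / (1 - α)) :=
      le_mul_of_one_le_right (by positivity) hexp
    _ = _ := by
      field_simp
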